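/- arXiv:1809.06816 — 2 statements merged into one kernel-verified Lean document; each statement's English description precedes it below -/
import Mathlib

section
/- Let X and Y be crowded topological spaces of countable π-weight such that X contains a subspace homeomorphic to the Cantor set 2^ω and Y does not. Then X × Y is not countable dense homogeneous. -/
open Set Topology

/-- A space is crowded if it is nonempty and has no isolated points. -/
def Crowded (X : Type*) [TopologicalSpace X] : Prop :=
  Nonempty X ∧ ∀ x : X, ¬ IsOpen ({x} : Set X)

/-- A space has countable π-weight if it has a countable π-base. -/
def CountablePiWeight (X : Type*) [TopologicalSpace X] : Prop :=
  ∃ B : Set (Set X), B.Countable ∧ (∀ U ∈ B, IsOpen U ∧ U.Nonempty) ∧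
    ∀ U : Set X, IsOpen U → U.Nonempty → ∃ V ∈ B, V ⊆ U

/-- Countable dense homogeneity. -/
def CDH (X : Type*) [TopologicalSpace X] : Prop :=
  ∀ D E : Set X, D.Countable → Dense D → E.Countable → Dense E →
    ∃ h : X ≃ₜ X, h '' D = E

/-- X contains a subspace homeomorphic to the Cantor set 2^ω. -/
def ContainsCantor (X : Type*) [TopologicalSpace X] : Prop :=
  ∃ S : Set X, Nonempty ((ℕ → Bool) ≃ₜ S)

/-- A sequence of nonempty open sets whose range is a π-base. -/
structure IsPiBaseSeq {Z : Type*} [TopologicalSpace Z] (B : ℕ → Set Z) : Prop where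
  isOpen : ∀ n, IsOpen (B n)
  nonempty : ∀ n, (B n).Nonempty
  exists_subset : ∀ U : Set Z, IsOpen U → U.Nonempty → ∃ n, B n ⊆ U

section CountableDense

variable {Z : Type*} [TopologicalSpace Z]

theorem CountablePiWeight.exists_isPiBaseSeq [Nonempty Z] (h : CountablePiWeight Z) :
    ∃ B : ℕ → Set Z, IsPiBaseSeq B := by
  obtain ⟨B, hc, hB, hπ⟩ := h
  obtain ⟨V, hV, -⟩ := hπ univ isOpen_univ univ_nonempty
  obtain ⟨f, rfl⟩ := hc.exists_eq_range ⟨V, hV⟩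
  refine ⟨f, fun n => (hB _ ⟨n, rfl⟩).1, fun n => (hB _ ⟨n, rfl⟩).2, fun U hU hne => ?_⟩
  obtain ⟨_, ⟨n, rfl⟩, hn⟩ := hπ U hU hne
  exact ⟨n, hn⟩

theorem IsPiBaseSeq.dense {B : ℕ → Set Z} (hB : IsPiBaseSeq B) {D : Set Z}
    (hD : ∀ n, (B n ∩ D).Nonempty) : Dense D := by
  refine dense_iff_inter_open.2 fun U hU hne => ?_
  obtain ⟨n, hn⟩ := hB.exists_subset U hU hne
  exact (hD n).mono (inter_subset_inter_left _ hn)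

/-- Recursive choice of a sequence each of whose terms depends on the finite set of earlier ones. -/
theorem exists_seq_of_forall_finset {α : Type*} (R : ℕ → α → Prop) (r : α → α → Prop)
    (h : ∀ n (s : Finset α), ∃ y, R n y ∧ ∀ x ∈ s, r x y) :
    ∃ f : ℕ → α, (∀ n, R n (f n)) ∧ ∀ m n, m < n → r (f m) (f n) := by
  classical
  choose c hR hr using h
  let s : ℕ → Finset α := fun n => Nat.rec ∅ (fun n s => insert (c n s) s) n
  have hs : ∀ n, s (n + 1) = insert (c n (s n)) (s n) := fun _ => rfl
  have hmono : Monotone s := monotone_nat_of_le_succ fun n => by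
    rw [hs]; exact Finset.subset_insert _ _
  refine ⟨fun n => c n (s n), fun n => hR _ _, fun m n hmn => hr _ _ _ (hmono hmn ?_)⟩
  rw [hs]; exact Finset.mem_insert_self _ _

/-- In a CDH space of countable π-weight, every subset invariant under all homeomorphisms is
open. -/
theorem CDH.isOpen_of_invariant (hZ : CDH Z) {B : ℕ → Set Z} (hB : IsPiBaseSeq B) {R : Set Z}
    (hR : ∀ (h : Z ≃ₜ Z), ∀ z ∈ R, h z ∈ R) : IsOpen R := by
  have : ∀ n, ∃ d ∈ B n, d ∈ R → B n ⊆ R := by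
    intro n
    by_cases h : B n ⊆ R
    · obtain ⟨d, hd⟩ := hB.nonempty n
      exact ⟨d, hd, fun _ => h⟩
    · obtain ⟨d, hd, hdR⟩ := not_subset.1 h
      exact ⟨d, hd, fun h' => absurd h' hdR⟩
  choose d hdB hdR using this
  have hD : Dense (range d) := hB.dense fun n => ⟨d n, hdB n, n, rfl⟩
  refine isOpen_iff_mem_nhds.2 fun y hy => ?_
  obtain ⟨h, hh⟩ := hZ (range d) (insert y (range d)) (countable_range d) hD
    ((countable_range d).insert y) (hD.mono (subset_insert _ _))
  obtain ⟨_, ⟨n, rfl⟩, hn⟩ : y ∈ h '' range d := hh ▸ mem_insert _ _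
  have hdn : d n ∈ R := by
    have := hR h.symm y hy
    rwa [← hn, h.symm_apply_apply] at this
  refine Filter.mem_of_superset ((h.isOpenMap _ (hB.isOpen n)).mem_nhds ⟨_, hdB n, hn⟩) ?_
  rintro _ ⟨z, hz, rfl⟩
  exact hR h z (hdR n hdn hz)

theorem CDH.t0Space (hZ : CDH Z) {B : ℕ → Set Z} (hB : IsPiBaseSeq B) : T0Space Z := by
  classical
  refine (t0Space_iff_inseparable Z).2 fun x y hxy => ?_
  by_contra hne
  choose d hd using hB.nonempty
  let ρ : Z → Z := fun z => (SeparationQuotient.mk z).out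
  have hρ : ∀ z, Inseparable (ρ z) z := fun z =>
    SeparationQuotient.mk_eq_mk.1 (Quotient.out_eq _)
  have hρ' : ∀ z w, Inseparable z w → ρ z = ρ w := fun z w h => by
    simp only [ρ, SeparationQuotient.mk_eq_mk.2 h]
  let D := range fun n => ρ (d n)
  have hDc : D.Countable := countable_range _
  have hD : Dense D := hB.dense fun n =>
    ⟨ρ (d n), ((hρ (d n)).mem_open_iff (hB.isOpen n)).2 (hd n), n, rfl⟩
  obtain ⟨h, hh⟩ := hZ D (D ∪ {x, y}) hDc hD (hDc.union (by simp)) (hD.mono subset_union_left)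
  obtain ⟨_, ⟨m, rfl⟩, hm⟩ : x ∈ h '' D := hh ▸ by simp
  obtain ⟨_, ⟨n, rfl⟩, hn⟩ : y ∈ h '' D := hh ▸ by simp
  apply hne
  rw [← hm, ← hn] at hxy ⊢
  have h1 : Inseparable (ρ (d m)) (ρ (d n)) := h.isInducing.inseparable_iff.1 hxy
  have h2 := hρ' _ _ (((hρ _).symm.trans h1).trans (hρ _))
  simp only [h2]

theorem CDH.interior_closure_singleton (hZ : CDH Z) (hcr : Crowded Z) {B : ℕ → Set Z}
    (hB : IsPiBaseSeq B) (z : Z) : interior (closure {z}) = ∅ := by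
  have := hZ.t0Space hB
  by_contra hne
  obtain ⟨w, hw⟩ := nonempty_iff_ne_empty.2 hne
  let R : Set Z := {z | z ∈ interior (closure {z})}
  have hR : IsOpen R := hZ.isOpen_of_invariant hB fun h z hz => by
    have : h z ∈ h '' interior (closure {z}) := mem_image_of_mem h hz
    rwa [h.image_interior, h.image_closure, image_singleton] at this
  have hgen : ∀ {u v : Z}, v ∈ interior (closure {u}) → u ∈ interior (closure {u}) := by
    intro u v hv
    obtain ⟨u', hu', rfl⟩ := mem_closure_iff.1 (interior_subset hv) _ isOpen_interior hv
    exact hu'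
  have hz : z ∈ R := hgen hw
  refine hcr.2 z ?_
  convert hR.inter (isOpen_interior (s := closure {z})) using 1
  refine Subset.antisymm (singleton_subset_iff.2 ⟨hz, hz⟩) ?_
  rintro u ⟨hu, huz⟩
  obtain ⟨z', hz', rfl⟩ := mem_closure_iff.1 (interior_subset huz) _ isOpen_interior hu
  exact ((specializes_iff_mem_closure.2 (interior_subset hz')).antisymm
    (specializes_iff_mem_closure.2 (interior_subset huz))).eq

theorem CDH.t1Space (hZ : CDH Z) (hcr : Crowded Z) {B : ℕ → Set Z} (hB : IsPiBaseSeq B) :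
    T1Space Z := by
  classical
  have := hZ.t0Space hB
  have hnd := hZ.interior_closure_singleton hcr hB
  obtain ⟨d, hdB, hd⟩ := exists_seq_of_forall_finset (fun n z => z ∈ B n)
    (fun x y => y ∉ closure {x}) fun n s => by
      have hs : ∀ s : Finset Z, Dense (⋂ x ∈ s, (closure {x})ᶜ) := by
        intro s
        induction s using Finset.induction_on with
        | empty => simp
        | insert a s _ ih =>
          rw [Finset.set_biInter_insert]
          exact (interior_eq_empty_iff_dense_compl.1 (hnd a)).inter_of_isOpen_left ih
            isClosed_closure.isOpen_compl
      obtain ⟨y, hy, hys⟩ := (hs s).inter_open_nonempty _ (hB.isOpen n) (hB.nonempty n)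
      exact ⟨y, hy, by simpa using hys⟩
  have hD : Dense (range d) := hB.dense fun n => ⟨d n, hdB n, n, rfl⟩
  have hDfin : ∀ z ∈ range d, (range d ∩ closure {z}).Finite := by
    rintro _ ⟨n, rfl⟩
    refine ((finite_Iic n).image d).subset ?_
    rintro _ ⟨⟨i, rfl⟩, hi⟩
    refine ⟨i, not_lt.1 fun hlt => hd n i hlt hi, rfl⟩
  have hfin : ∀ z : Z, (closure {z}).Finite := by
    intro z
    by_contra hinf
    obtain ⟨I, hI, hIc, hIinf⟩ : ∃ I ⊆ closure {z}, I.Countable ∧ I.Infinite := by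
      have := Set.Infinite.to_subtype hinf
      refine ⟨range fun n => (Infinite.natEmbedding (closure {z}) n : Z), ?_,
        countable_range _, ?_⟩
      · rintro _ ⟨n, rfl⟩
        exact Subtype.coe_prop _
      · exact infinite_range_of_injective
          (Subtype.val_injective.comp (Infinite.natEmbedding _).injective)
    obtain ⟨h, hh⟩ := hZ (range d) (range d ∪ insert z I) (countable_range d) hD
      ((countable_range d).union (hIc.insert z)) (hD.mono subset_union_left)
    obtain ⟨w, hw, rfl⟩ : z ∈ h '' range d := hh ▸ by simp
    refine hIinf (((hDfin w hw).image h).subset fun u hu => ?_)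
    rw [image_inter h.injective, hh, h.image_closure, image_singleton]
    exact ⟨Or.inr (Or.inr hu), hI hu⟩
  let R : Set Z := {z | IsClosed {z}}
  have hR : IsOpen R := hZ.isOpen_of_invariant hB fun h z hz => by
    have := h.isClosed_image.2 hz
    rwa [image_singleton] at this
  refine ⟨fun z => ?_⟩
  obtain ⟨w, hwz, hw⟩ := exists_min_image (closure {z}) (fun w => (closure {w}).ncard) (hfin z)
    ⟨z, subset_closure rfl⟩
  have hsub : ∀ {u v : Z}, u ∈ closure {v} → closure {u} ⊆ closure {v} := fun h =>
    closure_minimal (singleton_subset_iff.2 h) isClosed_closure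
  have hwR : w ∈ R := by
    have : closure {w} = {w} := by
      refine Subset.antisymm (fun u hu => ?_) subset_closure
      have := eq_of_subset_of_ncard_le (hsub hu) (hw u (hsub hwz hu)) (hfin w)
      exact (inseparable_iff_closure_eq.2 this).eq
    exact closure_eq_iff_isClosed.1 this
  obtain ⟨_, hz, rfl⟩ := mem_closure_iff.1 hwz R hR hwR
  exact hz

end CountableDense

theorem Crowded.neBot_nhdsNE {Z : Type*} [TopologicalSpace Z] (h : Crowded Z) (z : Z) :
    (𝓝[≠] z).NeBot :=
  ⟨fun h' => h.2 z ((isOpen_singleton_iff_punctured_nhds z).2 h')⟩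

/-- In a crowded T₁ space with a countable π-base one can pick points of prescribed members of the
π-base together with a point-finite family of `Gδ` sets around them. -/
theorem exists_pointFinite_isGδ {Y : Type*} [TopologicalSpace Y] [T1Space Y] (hcr : Crowded Y)
    {B : ℕ → Set Y} (hB : IsPiBaseSeq B) (j : ℕ → ℕ) :
    ∃ (a : ℕ → Y) (G : ℕ → Set Y), (∀ m, a m ∈ B (j m)) ∧ (∀ m, IsGδ (G m)) ∧
      (∀ m, a m ∈ G m) ∧ ∀ y, {m | y ∈ G m}.Finite := by
  classical
  have hne := hcr.neBot_nhdsNE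
  let O : ℕ → Set Y := fun i => B i ∪ interior (B i)ᶜ
  have hOo : ∀ i, IsOpen (O i) := fun i => (hB.isOpen i).union isOpen_interior
  have hOd : ∀ i, Dense (O i) := fun i => by
    refine dense_iff_inter_open.2 fun U hU hUne => ?_
    by_cases h : (U ∩ B i).Nonempty
    · exact h.mono (inter_subset_inter_right _ subset_union_left)
    · obtain ⟨u, hu⟩ := hUne
      refine ⟨u, hu, Or.inr (mem_interior.2 ⟨U, fun v hv hvB => h ⟨v, hv, hvB⟩, hU, hu⟩)⟩
  let P : ℕ → Set Y := fun m => ⋂ i ∈ Finset.range m, O i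
  have hPo : ∀ m, IsOpen (P m) := fun m => isOpen_biInter_finset fun i _ => hOo i
  have hPd : ∀ m, Dense (P m) := fun m => by
    induction m with
    | zero => simp [P]
    | succ m ih =>
      have : P (m + 1) = O m ∩ P m := by
        simp only [P, Finset.range_add_one, Finset.set_biInter_insert]
      rw [this]
      exact (hOd m).inter_of_isOpen_left ih (hOo m)
  let Γ : Set Y := ⋂ i, O i
  let T : Y → Set Y := fun y => ⋂ i, if y ∈ B i then B i else interior (B i)ᶜ
  have hTΓ : ∀ y, T y ⊆ Γ := fun y z hz => mem_iInter.2 fun i => by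
    have := mem_iInter.1 hz i
    split_ifs at this
    exacts [Or.inl this, Or.inr this]
  have hTself : ∀ y ∈ Γ, y ∈ T y := fun y hy => mem_iInter.2 fun i => by
    split_ifs with h
    exacts [h, (mem_iInter.1 hy i).resolve_left h]
  obtain ⟨f, hf, hfr⟩ := exists_seq_of_forall_finset (α := Y × ℕ)
    (fun m p => B p.2 ⊆ B (j m) ∧ p.1 ∈ B p.2 ∩ P m ∧ ((B p.2 ∩ Γ).Nonempty → p.1 ∈ Γ))
    (fun p q => p.1 ∉ B q.2) fun m s => by
      have h1 : (B (j m) ∩ (s.image Prod.fst : Set Y)ᶜ).Nonempty := by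
        have : Dense ((s.image Prod.fst : Finset Y) : Set Y)ᶜ := by
          rw [compl_eq_univ_sdiff]
          exact dense_univ.sdiff_finite (Finset.finite_toSet _)
        simpa using this.inter_open_nonempty _ (hB.isOpen _) (hB.nonempty (j m))
      obtain ⟨k, hk⟩ := hB.exists_subset _
        ((hB.isOpen _).inter (s.image Prod.fst : Finset Y).finite_toSet.isClosed.isOpen_compl)
        (by simpa using h1)
      have hks : ∀ p ∈ s, p.1 ∉ B k := fun p hp hpk =>
        (hk hpk).2 (by simpa using ⟨p.2, hp⟩)
      by_cases hΓ : (B k ∩ Γ).Nonempty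
      · obtain ⟨y, hy, hyΓ⟩ := hΓ
        exact ⟨(y, k), ⟨fun z hz => (hk hz).1,
          ⟨hy, mem_iInter₂.2 fun i _ => mem_iInter.1 hyΓ i⟩, fun _ => hyΓ⟩, hks⟩
      · obtain ⟨y, hy⟩ := (hPd m).inter_open_nonempty _ (hB.isOpen k) (hB.nonempty k)
        exact ⟨(y, k), ⟨fun z hz => (hk hz).1, hy, fun h => absurd h hΓ⟩, hks⟩
  refine ⟨fun m => (f m).1,
    fun m => if (f m).1 ∈ Γ then T (f m).1 else B (f m).2 ∩ P m,
    fun m => (hf m).1 (hf m).2.1.1, fun m => ?_, fun m => ?_, fun y => ?_⟩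
  · dsimp only
    split_ifs
    · refine IsGδ.iInter_of_isOpen fun i => ?_
      split_ifs
      exacts [hB.isOpen i, isOpen_interior]
    · exact ((hB.isOpen _).inter (hPo m)).isGδ
  · dsimp only
    split_ifs with h
    exacts [hTself _ h, (hf m).2.1]
  · by_cases hy : y ∈ Γ
    · have key : ∀ m, y ∈ (if (f m).1 ∈ Γ then T (f m).1 else B (f m).2 ∩ P m) →
          y ∈ T (f m).1 := fun m hm => by
        split_ifs at hm with h
        · exact hm
        · exact absurd ((hf m).2.2 ⟨y, hm.1, hy⟩) h
      have aux : ∀ m n, m < n → y ∈ T (f m).1 → y ∉ T (f n).1 := fun m n hmn hm hn => by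
        have h1 := mem_iInter.1 hm (f n).2
        have h2 := mem_iInter.1 hn (f n).2
        rw [if_neg (hfr m n hmn)] at h1
        rw [if_pos (hf n).2.1.1] at h2
        exact interior_subset h1 h2
      refine Set.Subsingleton.finite fun m hm n hn => ?_
      rcases lt_trichotomy m n with h | h | h
      · exact absurd (key n hn) (aux m n h (key m hm))
      · exact h
      · exact absurd (key m hm) (aux n m h (key n hn))
    · obtain ⟨i, hi⟩ : ∃ i, y ∉ O i := by simpa [Γ] using hy
      refine (finite_Iic i).subset fun m hm => ?_
      rw [mem_ofPred_eq] at hm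
      dsimp only at hm
      split_ifs at hm with h
      · exact absurd (hTΓ _ hm) hy
      · refine not_lt.1 fun hlt => hi (mem_iInter₂.1 hm.2 i (Finset.mem_range.2 hlt))

section Fusion

/-- The image of `s` is contained in an open set which the image of `t` misses. -/
def SeparatedFrom {K Y : Type*} [TopologicalSpace Y] (f : K → Y) (s t : Set K) : Prop :=
  ∃ W : Set Y, IsOpen W ∧ s ⊆ f ⁻¹' W ∧ Disjoint t (f ⁻¹' W)

theorem SeparatedFrom.mono {K Y : Type*} [TopologicalSpace Y] {f : K → Y} {s t s' t' : Set K}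
    (h : SeparatedFrom f s t) (hs : s' ⊆ s) (ht : t' ⊆ t) : SeparatedFrom f s' t' := by
  obtain ⟨W, hW, hsW, htW⟩ := h
  exact ⟨W, hW, hs.trans hsW, htW.mono_left ht⟩

theorem exists_shrinking_separatedFrom {K Y ι : Type*} [TopologicalSpace K] [TopologicalSpace Y]
    {f : K → Y}
    (H : ∀ s t : Set K, IsOpen s → s.Nonempty → IsOpen t → t.Nonempty →
      ∃ s' t' : Set K, IsOpen s' ∧ s'.Nonempty ∧ IsOpen t' ∧ t'.Nonempty ∧ s' ⊆ s ∧ t' ⊆ t ∧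
        SeparatedFrom f s' t')
    (U : ι → Set K) (hU : ∀ i, IsOpen (U i) ∧ (U i).Nonempty) (P : Finset (ι × ι)) :
    ∃ V : ι → Set K, (∀ i, IsOpen (V i) ∧ (V i).Nonempty ∧ V i ⊆ U i) ∧
      ∀ p ∈ P, p.1 ≠ p.2 → SeparatedFrom f (V p.1) (V p.2) := by
  classical
  induction P using Finset.induction_on with
  | empty => exact ⟨U, fun i => ⟨(hU i).1, (hU i).2, Subset.rfl⟩, by simp⟩
  | insert p P _ ih =>
    obtain ⟨V, hV, hVP⟩ := ih
    by_cases hp : p.1 = p.2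
    · refine ⟨V, hV, fun q hq hne => ?_⟩
      rcases Finset.mem_insert.1 hq with rfl | hq
      exacts [absurd hp hne, hVP q hq hne]
    obtain ⟨s, t, hs, hsn, ht, htn, hss, htt, hst⟩ :=
      H (V p.1) (V p.2) (hV _).1 (hV _).2.1 (hV _).1 (hV _).2.1
    let V' : ι → Set K := Function.update (Function.update V p.1 s) p.2 t
    have h2 : V' p.2 = t := Function.update_self ..
    have h1 : V' p.1 = s := by
      rw [show V' p.1 = Function.update V p.1 s p.1 from Function.update_of_ne hp _ _]
      exact Function.update_self ..
    have h3 : ∀ i, i ≠ p.1 → i ≠ p.2 → V' i = V i := fun i hi hi' => by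
      rw [show V' i = Function.update V p.1 s i from Function.update_of_ne hi' _ _]
      exact Function.update_of_ne hi _ _
    have h4 : ∀ i, IsOpen (V' i) ∧ (V' i).Nonempty ∧ V' i ⊆ V i := fun i => by
      by_cases hi : i = p.1
      · subst hi; rw [h1]; exact ⟨hs, hsn, hss⟩
      by_cases hi' : i = p.2
      · subst hi'; rw [h2]; exact ⟨ht, htn, htt⟩
      rw [h3 i hi hi']
      exact ⟨(hV i).1, (hV i).2.1, Subset.rfl⟩
    refine ⟨V', fun i => ⟨(h4 i).1, (h4 i).2.1, (h4 i).2.2.trans (hV i).2.2⟩, fun q hq hne => ?_⟩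
    rcases Finset.mem_insert.1 hq with rfl | hq
    · rwa [h1, h2]
    · exact (hVP q hq hne).mono (h4 _).2.2 (h4 _).2.2

theorem containsCantor_of_separatedFrom {Y : Type*} [TopologicalSpace Y] {f : (ℕ → Bool) → Y}
    (hf : Continuous f)
    (H : ∀ s t : Set (ℕ → Bool), IsOpen s → s.Nonempty → IsOpen t → t.Nonempty →
      ∃ s' t' : Set (ℕ → Bool), IsOpen s' ∧ s'.Nonempty ∧ IsOpen t' ∧ t'.Nonempty ∧ s' ⊆ s ∧
        t' ⊆ t ∧ SeparatedFrom f s' t') :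
    ContainsCantor Y := by
  classical
  let cyl : (ℕ → Bool) × ℕ → Set (ℕ → Bool) := fun p => PiNat.cylinder p.1 p.2
  have step : ∀ n (U : (Fin n → Bool) → (ℕ → Bool) × ℕ),
      ∃ U' : (Fin (n + 1) → Bool) → (ℕ → Bool) × ℕ,
        (∀ s, cyl (U' s) ⊆ cyl (U (Fin.init s)) ∧ n + 1 ≤ (U' s).2) ∧
        ∀ s t, s ≠ t → SeparatedFrom f (cyl (U' s)) (cyl (U' t)) := by
    intro n U
    obtain ⟨V, hV, hsep⟩ := exists_shrinking_separatedFrom H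
      (fun s : Fin (n + 1) → Bool => cyl (U (Fin.init s)))
      (fun s => ⟨PiNat.isOpen_cylinder _ _ _, _, PiNat.self_mem_cylinder _ _⟩) Finset.univ
    have : ∀ s, ∃ p : (ℕ → Bool) × ℕ, cyl p ⊆ V s ∧ n + 1 ≤ p.2 := by
      intro s
      obtain ⟨x, hx⟩ := (hV s).2.1
      obtain ⟨_, ⟨z, m, rfl⟩, hxz, hzV⟩ :=
        (PiNat.isTopologicalBasis_cylinders fun _ : ℕ => Bool).exists_subset_of_mem_open hx
          (hV s).1
      exact ⟨(z, max m (n + 1)), (PiNat.cylinder_anti z (le_max_left _ _)).trans hzV,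
        le_max_right _ _⟩
    choose U' hU'V hU'n using this
    exact ⟨U', fun s => ⟨(hU'V s).trans (hV s).2.2, hU'n s⟩, fun s t hst =>
      (hsep (s, t) (Finset.mem_univ _) hst).mono (hU'V s) (hU'V t)⟩
  choose F hF hFsep using step
  let C : ∀ n, (Fin n → Bool) → (ℕ → Bool) × ℕ := fun n =>
    Nat.rec (fun _ => (fun _ => false, 0)) (fun n U => F n U) n
  let c : (ℕ → Bool) → ℕ → (ℕ → Bool) × ℕ := fun x n => C n fun i => x i
  have hc : ∀ x n, cyl (c x (n + 1)) ⊆ cyl (c x n) := fun x n => (hF n (C n) _).1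
  have hcn : ∀ x n, n ≤ (c x n).2 := fun x n => by
    cases n with
    | zero => exact Nat.zero_le _
    | succ n => exact (hF n (C n) _).2
  have hanti : ∀ x, Antitone fun n => cyl (c x n) := fun x => antitone_nat_of_succ_le (hc x)
  let β : (ℕ → Bool) → ℕ → Bool := fun x i => (c x (i + 1)).1 i
  have hβ : ∀ x n, β x ∈ cyl (c x n) := by
    intro x n
    refine PiNat.mem_cylinder_iff.2 fun i hi => ?_
    rcases le_total n (i + 1) with h | h
    · exact PiNat.mem_cylinder_iff.1 (hanti x h (PiNat.self_mem_cylinder _ _)) i hi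
    · exact (PiNat.mem_cylinder_iff.1 (hanti x h (PiNat.self_mem_cylinder _ _)) i
        (hcn x (i + 1))).symm
  have hβc : Continuous β := by
    refine continuous_pi fun i => ?_
    have : Continuous fun x : ℕ → Bool => fun k : Fin (i + 1) => x k := by fun_prop
    exact (continuous_of_discreteTopology
      (f := fun s : Fin (i + 1) → Bool => (C (i + 1) s).1 i)).comp this
  have hind : IsInducing (f ∘ β) := by
    refine isInducing_iff_nhds.2 fun x => le_antisymm ?_ fun S hS => ?_
    · exact ((hf.comp hβc).tendsto x).le_comap
    · obtain ⟨T, hTS, hTo, hxT⟩ := mem_nhds_iff.1 hS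
      obtain ⟨_, ⟨z, n, rfl⟩, hxz, hzT⟩ :=
        (PiNat.isTopologicalBasis_cylinders fun _ : ℕ => Bool).exists_subset_of_mem_open hxT hTo
      have : ∀ t : Fin (n + 1) → Bool, ∃ W : Set Y, IsOpen W ∧ f (β x) ∈ W ∧
          (t ≠ (fun i : Fin (n + 1) => x i) → Disjoint (cyl (C (n + 1) t)) (f ⁻¹' W)) := by
        intro t
        by_cases ht : t = fun i : Fin (n + 1) => x i
        · exact ⟨univ, isOpen_univ, mem_univ _, fun h => absurd ht h⟩
        · obtain ⟨W, hW, h1, h2⟩ := hFsep n (C n) (fun i : Fin (n + 1) => x i) t (Ne.symm ht)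
          exact ⟨W, hW, h1 (hβ x (n + 1)), fun _ => h2⟩
      choose W hWo hWx hWt using this
      refine ⟨⋂ t, W t, (isOpen_iInter_of_finite hWo).mem_nhds (mem_iInter.2 hWx), ?_⟩
      intro x' hx'
      refine hTS (hzT ?_)
      have heq : (fun i : Fin (n + 1) => x' i) = fun i : Fin (n + 1) => x i := by
        by_contra hne
        exact disjoint_left.1 (hWt _ hne) (hβ x' (n + 1)) (mem_iInter.1 hx' _)
      refine PiNat.mem_cylinder_iff.2 fun i hi => ?_
      rw [← PiNat.mem_cylinder_iff.1 hxz i hi]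
      exact congrFun heq ⟨i, hi.trans (Nat.lt_succ_self n)⟩
  exact ⟨_, ⟨hind.isEmbedding.toHomeomorph⟩⟩

end Fusion

theorem not_isOpen_singleton_cantor (x : ℕ → Bool) : ¬ IsOpen ({x} : Set (ℕ → Bool)) := by
  intro h
  obtain ⟨_, ⟨z, n, rfl⟩, hxz, hz⟩ :=
    (PiNat.isTopologicalBasis_cylinders fun _ : ℕ => Bool).exists_subset_of_mem_open
      (mem_singleton x) h
  have : Function.update x n (!x n) ∈ PiNat.cylinder z n := PiNat.mem_cylinder_iff.2 fun i hi => by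
    rw [Function.update_of_ne hi.ne]
    exact PiNat.mem_cylinder_iff.1 hxz i hi
  have := congrFun (hz this) n
  simp at this

theorem crowded_cantor : Crowded (ℕ → Bool) := ⟨inferInstance, not_isOpen_singleton_cantor⟩

/-- If a countable set `{(x m, a m)}` of a product has its second coordinates in a point-finite
family of `Gδ` sets, then it is not dense in a Cantor set unless the second factor contains a
Cantor set. -/
theorem containsCantor_of_dense_preimage {X Y : Type*} [TopologicalSpace X] [TopologicalSpace Y]
    {x : ℕ → X} {a : ℕ → Y} {G : ℕ → Set Y} (hG : ∀ m, IsGδ (G m)) (haG : ∀ m, a m ∈ G m)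
    (hfin : ∀ y, {m | y ∈ G m}.Finite) {ψ : (ℕ → Bool) → X × Y} (hψ : Continuous ψ)
    (hinj : Function.Injective ψ) (hd : Dense (ψ ⁻¹' range fun m => (x m, a m))) :
    ContainsCantor Y := by
  have hne := crowded_cantor.neBot_nhdsNE
  have hf : Continuous fun p => (ψ p).2 := continuous_snd.comp hψ
  refine containsCantor_of_separatedFrom hf fun s t hs hsn ht htn => ?_
  by_contra hcon
  have hW : ∀ W : Set Y, IsOpen W → ∀ p ∈ s, (ψ p).2 ∈ W →
      t ⊆ closure ((fun p => (ψ p).2) ⁻¹' W) := by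
    intro W hWo p hp hpW
    by_contra hsub
    obtain ⟨q, hqt, hq⟩ := not_subset.1 hsub
    refine hcon ⟨s ∩ (fun p => (ψ p).2) ⁻¹' W, t ∩ (closure ((fun p => (ψ p).2) ⁻¹' W))ᶜ,
      hs.inter (hWo.preimage hf), ⟨p, hp, hpW⟩, ht.inter isClosed_closure.isOpen_compl,
      ⟨q, hqt, hq⟩, inter_subset_left, inter_subset_left, W, hWo, inter_subset_right, ?_⟩
    exact disjoint_left.2 fun z hz hzW => hz.2 (subset_closure hzW)
  let J : Set ℕ := {m | ∃ p ∈ s, ψ p = (x m, a m)}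
  have hJ : J.Infinite := by
    intro hJfin
    have h1 : (s ∩ ψ ⁻¹' range fun m => (x m, a m)).Finite := by
      refine ((hJfin.image fun m => (x m, a m)).preimage hinj.injOn).subset ?_
      rintro p ⟨hp, m, hm⟩
      exact ⟨m, ⟨p, hp, hm.symm⟩, hm⟩
    obtain ⟨p, hp, hpd, hpn⟩ := (hd.sdiff_finite h1).inter_open_nonempty s hs hsn
    exact hpn ⟨hp, hpd⟩
  have hG' : ∀ m, ∃ W : ℕ → Set Y, (∀ i, IsOpen (W i)) ∧ G m = ⋂ i, W i := fun m =>
    (hG m).eq_iInter_nat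
  choose W hWo hWG using hG'
  let E : ℕ × ℕ → Set (ℕ → Bool) := fun q =>
    (fun p => (ψ p).2) ⁻¹' W q.1 q.2 ∪ (closure ((fun p => (ψ p).2) ⁻¹' W q.1 q.2))ᶜ
  have hE : Dense (⋂ q, E q) := by
    refine dense_iInter_of_isOpen
      (fun q => ((hWo _ _).preimage hf).union isClosed_closure.isOpen_compl) fun q => ?_
    intro p
    by_cases hp : p ∈ closure ((fun p => (ψ p).2) ⁻¹' W q.1 q.2)
    · exact closure_mono subset_union_left hp
    · exact subset_closure (Or.inr hp)
  obtain ⟨p, hpt, hp⟩ := hE.inter_open_nonempty t ht htn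
  refine hJ ((hfin (ψ p).2).subset ?_)
  rintro m ⟨q, hqs, hq⟩
  change (ψ p).2 ∈ G m
  rw [hWG]
  refine mem_iInter.2 fun i => (mem_iInter.1 hp (m, i)).resolve_right fun h => h ?_
  refine hW _ (hWo m i) q hqs ?_ hpt
  rw [hq]
  have := haG m
  rw [hWG] at this
  exact mem_iInter.1 this i

theorem product_CDH_cantor_restriction (X Y : Type*) [TopologicalSpace X]
    [TopologicalSpace Y] (hX : Crowded X) (hY : Crowded Y)
    (hpX : CountablePiWeight X) (hpY : CountablePiWeight Y)
    (hcX : ContainsCantor X) (hcY : ¬ ContainsCantor Y) :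
    ¬ CDH (X × Y) := by
  intro hZ
  have := hX.1
  have := hY.1
  obtain ⟨A, hA⟩ := hpX.exists_isPiBaseSeq
  obtain ⟨B, hB⟩ := hpY.exists_isPiBaseSeq
  have hAB : IsPiBaseSeq fun n : ℕ => A n.unpair.1 ×ˢ B n.unpair.2 := by
    refine ⟨fun n => (hA.isOpen _).prod (hB.isOpen _),
      fun n => (hA.nonempty _).prod (hB.nonempty _), fun U hU ⟨⟨u, v⟩, huv⟩ => ?_⟩
    obtain ⟨S, T, hS, hT, hu, hv, hST⟩ := isOpen_prod_iff.1 hU u v huv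
    obtain ⟨i, hi⟩ := hA.exists_subset S hS ⟨u, hu⟩
    obtain ⟨j, hj⟩ := hB.exists_subset T hT ⟨v, hv⟩
    refine ⟨Nat.pair i j, ?_⟩
    simpa using (prod_mono hi hj).trans hST
  have hcr : Crowded (X × Y) := by
    refine ⟨inferInstance, fun z hz => hX.2 z.1 ?_⟩
    simpa using isOpenMap_fst _ hz
  have := hZ.t1Space hcr hAB
  have : T1Space Y := by
    obtain ⟨u⟩ := hX.1
    exact (isEmbedding_prodMkRight u).t1Space
  obtain ⟨a, G, haB, hG, haG, hfin⟩ := exists_pointFinite_isGδ hY hB fun n => n.unpair.2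
  choose x hx using fun n : ℕ => hA.nonempty n.unpair.1
  let E : Set (X × Y) := range fun m => (x m, a m)
  have hEc : E.Countable := countable_range _
  have hE : Dense E := hAB.dense fun n => ⟨(x n, a n), ⟨hx n, haB n⟩, n, rfl⟩
  obtain ⟨S, ⟨φ⟩⟩ := hcX
  obtain ⟨v⟩ := hY.1
  let κ : (ℕ → Bool) → X × Y := fun p => (φ p, v)
  obtain ⟨Q, hQc, hQ⟩ := TopologicalSpace.exists_countable_dense (ℕ → Bool)
  obtain ⟨h, hh⟩ := hZ (E ∪ κ '' Q) E (hEc.union (hQc.image κ)) (hE.mono subset_union_left) hEc hE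
  refine hcY (containsCantor_of_dense_preimage (x := x) hG haG hfin (ψ := h ∘ κ)
    (h.continuous.comp (by fun_prop)) (h.injective.comp fun p q hpq => ?_) (hQ.mono ?_))
  · exact φ.injective (Subtype.ext (congrArg Prod.fst hpq))
  · intro q hq
    have : h (κ q) ∈ h '' (E ∪ κ '' Q) := mem_image_of_mem h (Or.inr (mem_image_of_mem κ hq))
    rwa [hh] at this
end

section
/- Let Z be a crowded space of countable π-weight that contains no subspace homeomorphic to the Cantor set 2^ω. Then the countable power Z^ω is not countable dense homogeneous. -/
open Set Topology

/-- A sequential π-base of a countable power, made of boxes with finite support. -/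
theorem CountablePiWeight.exists_seq_boxes {Z : Type*} [TopologicalSpace Z] [Nonempty Z]
    (hp : CountablePiWeight Z) :
    ∃ (N : ℕ → ℕ) (V : ℕ → ℕ → Set Z), (∀ n i, IsOpen (V n i) ∧ (V n i).Nonempty) ∧
      ∀ U : Set (ℕ → Z), IsOpen U → U.Nonempty →
        ∃ n, ∀ f : ℕ → Z, (∀ i < N n, f i ∈ V n i) → f ∈ U := by
  obtain ⟨B, hBc, hBo, hB⟩ := hp
  have hBne : B.Nonempty := by
    obtain ⟨V, hV, -⟩ := hB univ isOpen_univ univ_nonempty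
    exact ⟨V, hV⟩
  obtain ⟨b, rfl⟩ := hBc.exists_eq_range hBne
  refine ⟨fun n => (Denumerable.ofNat (List ℕ) n).length,
    fun n i => b ((Denumerable.ofNat (List ℕ) n).getD i 0), fun n i => hBo _ ⟨_, rfl⟩, ?_⟩
  rintro U hU ⟨f₀, hf₀⟩
  obtain ⟨I, u, hu, hIU⟩ := isOpen_pi_iff.1 hU f₀ hf₀
  have hk : ∀ i, ∃ k, i ∈ I → b k ⊆ u i := by
    intro i
    by_cases hi : i ∈ I
    · obtain ⟨_, ⟨k, rfl⟩, hk⟩ := hB (u i) (hu i hi).1 ⟨_, (hu i hi).2⟩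
      exact ⟨k, fun _ => hk⟩
    · exact ⟨0, fun h => absurd h hi⟩
  choose k hk using hk
  refine ⟨Encodable.encode ((List.range (I.sup id + 1)).map k), fun f hf => hIU fun i hi => ?_⟩
  have hi' : i < I.sup id + 1 := Nat.lt_succ_of_le (Finset.le_sup (f := id) hi)
  have := hf i (by simpa using hi')
  simp only [Denumerable.ofNat_encode] at this
  rw [List.getD_eq_getElem _ _ (by simpa using hi')] at this
  simp only [List.getElem_map, List.getElem_range] at this
  exact hk i hi this

/-- A sequence of infinite sets has an injective choice function. -/
theorem exists_injective_forall_mem_of_infinite {α : Type*} (S : ℕ → Set α)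
    (hS : ∀ n, (S n).Infinite) : ∃ d : ℕ → α, Function.Injective d ∧ ∀ n, d n ∈ S n := by
  classical
  choose pick hpick hnot using fun (n : ℕ) (F : Finset α) => (hS n).exists_notMem_finset F
  let l : ℕ → Finset α := fun n => Nat.rec ∅ (fun n F => insert (pick n F) F) n
  have hl : ∀ n, l (n + 1) = insert (pick n (l n)) (l n) := fun _ => rfl
  have hmem : ∀ n m, m < n → pick m (l m) ∈ l n := by
    intro n
    induction n with
    | zero => simp
    | succ n ih =>
      intro m hm
      rw [hl, Finset.mem_insert]
      rcases Nat.lt_succ_iff_lt_or_eq.1 hm with h | rfl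
      · exact Or.inr (ih m h)
      · exact Or.inl rfl
  refine ⟨fun n => pick n (l n), ?_, fun n => hpick _ _⟩
  have hne : ∀ m n, m < n → pick m (l m) ≠ pick n (l n) := fun m n hmn he =>
    hnot n (l n) (he ▸ hmem n m hmn)
  intro m n he
  rcases lt_trichotomy m n with h | h | h
  · exact absurd he (hne m n h)
  · exact h
  · exact absurd he.symm (hne n m h)

theorem Crowded.infinite_of_isOpen {Z : Type*} [TopologicalSpace Z] [T1Space Z]
    (hZ : Crowded Z) {U : Set Z} (hU : IsOpen U) (hne : U.Nonempty) : U.Infinite := by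
  intro hfin
  obtain ⟨x, hx⟩ := hne
  apply hZ.2 x
  have : ({x} : Set Z) = U \ (U \ {x}) := by
    ext y
    simp only [mem_singleton_iff, mem_sdiff]
    grind
  rw [this]
  exact hU.sdiff (hfin.subset sdiff_subset).isClosed

theorem not_isOpen_singleton_nat_bool (s : ℕ → Bool) : ¬ IsOpen ({s} : Set (ℕ → Bool)) := by
  intro h
  obtain ⟨I, u, hu, hI⟩ := isOpen_pi_iff.1 h s rfl
  obtain ⟨i, hi⟩ := Infinite.exists_notMem_finset I
  have : Function.update s i (!s i) ∈ ({s} : Set (ℕ → Bool)) := by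
    apply hI
    intro j hj
    have hji : j ≠ i := by rintro rfl; exact hi hj
    simpa [Function.update_of_ne hji] using (hu j hj).2
  have := congrFun this i
  simp at this

/-- A Hausdorff continuous image of a second countable compact space is second countable. -/
theorem Continuous.secondCountableTopology_of_surjective {X Y : Type*} [TopologicalSpace X]
    [TopologicalSpace Y] [CompactSpace X] [SecondCountableTopology X] [T2Space Y] {g : X → Y}
    (hg : Continuous g) (hs : Function.Surjective g) : SecondCountableTopology Y := by
  let b := TopologicalSpace.countableBasis X
  let C : Set (Set Y) := (fun F : Set (Set X) => kernImage g (⋃₀ F)) '' {F | F.Finite ∧ F ⊆ b}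
  have hC : C.Countable :=
    (countable_ofPred_finite_subset (TopologicalSpace.countable_countableBasis X)).image _
  have hbasis : TopologicalSpace.IsTopologicalBasis C := by
    apply TopologicalSpace.isTopologicalBasis_of_isOpen_of_nhds
    · rintro _ ⟨F, ⟨-, hF⟩, rfl⟩
      have ho : IsOpen (⋃₀ F) :=
        isOpen_sUnion fun t ht => TopologicalSpace.isOpen_of_mem_countableBasis (hF ht)
      simp only [kernImage_eq_compl]
      exact (hg.isClosedMap _ ho.isClosed_compl).isOpen_compl
    · intro y u hy hu
      have hK : IsCompact (g ⁻¹' {y}) := (isClosed_singleton.preimage hg).isCompact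
      obtain ⟨T, hTb, hTfin, hT⟩ := hK.elim_finite_subcover_image
        (b := {t | t ∈ b ∧ t ⊆ g ⁻¹' u}) (c := id)
        (fun t ht => TopologicalSpace.isOpen_of_mem_countableBasis ht.1) (by
          intro x hx
          have hxu : x ∈ g ⁻¹' u := by
            rw [mem_preimage, show g x = y from hx]
            exact hy
          obtain ⟨t, ht, hxt, htu⟩ :=
            (TopologicalSpace.isBasis_countableBasis X).exists_subset_of_mem_open hxu
              (hu.preimage hg)
          exact mem_biUnion (show t ∈ {t | t ∈ b ∧ t ⊆ g ⁻¹' u} from ⟨ht, htu⟩) hxt)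
      refine ⟨_, ⟨T, ⟨hTfin, fun t ht => (hTb ht).1⟩, rfl⟩, ?_, ?_⟩
      · intro x hx
        simpa [sUnion_eq_biUnion] using hT hx
      · intro z hz
        obtain ⟨x, rfl⟩ := hs z
        obtain ⟨t, ht, hxt⟩ := hz (show g x = g x from rfl)
        exact (hTb ht).2 hxt
  exact hbasis.secondCountableTopology hC

/-- If a map from the Cantor set to a Hausdorff space is injective on a dense set, then its range
contains a Cantor set. -/
theorem containsCantor_of_injOn_dense {Z : Type*} [TopologicalSpace Z] [T2Space Z]
    {g : (ℕ → Bool) → Z} (hg : Continuous g) {Q : Set (ℕ → Bool)} (hQ : Dense Q)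
    (hinj : InjOn g Q) : ContainsCantor Z := by
  have hs : Function.Surjective (rangeFactorization g) := rangeFactorization_surjective
  have hg' : Continuous (rangeFactorization g) := hg.rangeFactorization
  have : CompactSpace (range g) := isCompact_iff_compactSpace.1 (isCompact_range hg)
  have : SecondCountableTopology (range g) := hg'.secondCountableTopology_of_surjective hs
  let _ := TopologicalSpace.metrizableSpaceMetric (range g)
  have hperf : PerfectSpace (range g) := by
    rw [perfectSpace_iff_forall_not_isolated]
    intro x
    by_contra hx
    have hx : IsOpen {x} := by
      rw [isOpen_singleton_iff_punctured_nhds]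
      simpa [Filter.not_neBot] using hx
    have hO : IsOpen (rangeFactorization g ⁻¹' {x}) := hx.preimage hg'
    obtain ⟨s, hs⟩ := hs x
    obtain ⟨p, hpO, hpQ⟩ := hQ.inter_open_nonempty _ hO ⟨s, hs⟩
    have hne : (rangeFactorization g ⁻¹' {x} \ {p}).Nonempty := by
      by_contra hempty
      rw [not_nonempty_iff_eq_empty, sdiff_eq_empty] at hempty
      apply not_isOpen_singleton_nat_bool p
      rwa [← hempty.antisymm (singleton_subset_iff.2 hpO)]
    obtain ⟨q, ⟨hqO, hqp⟩, hqQ⟩ :=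
      hQ.inter_open_nonempty _ (hO.sdiff isClosed_singleton) hne
    apply hqp
    apply hinj hqQ hpQ
    have : rangeFactorization g q = rangeFactorization g p :=
      (show _ = x from hqO).trans (show _ = x from hpO).symm
    exact congrArg Subtype.val this
  obtain ⟨f, -, hf, hfi⟩ := Perfect.exists_nat_bool_injection
    (C := (univ : Set (range g))) ⟨isClosed_univ, hperf.univ_preperfect⟩
    ⟨⟨g default, mem_range_self _⟩, trivial⟩
  have hemb : IsClosedEmbedding (fun s => (f s : Z)) :=
    (continuous_subtype_val.comp hf).isClosedEmbedding (Subtype.val_injective.comp hfi)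
  exact ⟨range (fun s => (f s : Z)), ⟨hemb.toIsEmbedding.toHomeomorph⟩⟩

/-- A dense countable set of a countable power on which the first projection is injective. -/
theorem Crowded.exists_dense_injOn_eval {Z : Type*} [TopologicalSpace Z] [T1Space Z]
    (hZ : Crowded Z) (hp : CountablePiWeight Z) :
    ∃ D : Set (ℕ → Z), D.Countable ∧ Dense D ∧ InjOn (fun f : ℕ → Z => f 0) D := by
  have := hZ.1
  obtain ⟨N, V, hV, hB⟩ := hp.exists_seq_boxes
  choose d hd hdV using fun i => exists_injective_forall_mem_of_infinite (fun n => V n i)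
    fun n => hZ.infinite_of_isOpen (hV n i).1 (hV n i).2
  refine ⟨range fun n i => d i n, countable_range _, ?_, ?_⟩
  · rw [dense_iff_inter_open]
    intro U hU hne
    obtain ⟨n, hn⟩ := hB U hU hne
    exact ⟨_, hn _ fun i _ => hdV i n, mem_range_self n⟩
  · rintro _ ⟨m, rfl⟩ _ ⟨n, rfl⟩ h
    rw [hd 0 h]

/-- If `Z` has two disjoint nonempty open sets, then its countable power has a countable dense set
whose points are pairwise separated by open sets. -/
theorem CountablePiWeight.exists_dense_separated {Z : Type*} [TopologicalSpace Z]
    (hp : CountablePiWeight Z) {U V : Set Z} (hU : IsOpen U) (hV : IsOpen V)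
    (hUne : U.Nonempty) (hVne : V.Nonempty) (hUV : Disjoint U V) :
    ∃ D : Set (ℕ → Z), D.Countable ∧ Dense D ∧
      ∀ p ∈ D, ∀ q ∈ D, p ≠ q → SeparatedNhds {p} {q} := by
  classical
  obtain ⟨u, hu⟩ := hUne
  obtain ⟨v, hv⟩ := hVne
  have : Nonempty Z := ⟨u⟩
  obtain ⟨N, W, hW, hB⟩ := hp.exists_seq_boxes
  choose w hw using fun n i => (hW n i).2
  let k : ℕ → ℕ := fun n => n + ∑ i ∈ Finset.range (n + 1), N i
  have hkN : ∀ m n, m ≤ n → N m ≤ k n := fun m n hmn =>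
    (Finset.single_le_sum (f := N) (fun _ _ => Nat.zero_le _)
      (Finset.mem_range.2 (Nat.lt_succ_of_le hmn))).trans (Nat.le_add_left _ _)
  have hk : StrictMono k := strictMono_nat_of_lt_succ fun n => by
    simp only [k, Finset.sum_range_succ _ (n + 1)]
    omega
  let d : ℕ → ℕ → Z := fun n i => if i < N n then w n i else if i = k n then v else u
  have hsep : ∀ m n, m < n → SeparatedNhds {d m} {d n} := by
    intro m n hmn
    refine ⟨(fun f => f (k n)) ⁻¹' U, (fun f => f (k n)) ⁻¹' V,
      hU.preimage (continuous_apply _), hV.preimage (continuous_apply _), ?_, ?_,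
      hUV.preimage _⟩
    · have h₁ : ¬ k n < N m := not_lt.2 (hkN m n hmn.le)
      have h₂ : k n ≠ k m := (hk hmn).ne'
      simpa [d, h₁, h₂] using hu
    · have h₁ : ¬ k n < N n := not_lt.2 (hkN n n le_rfl)
      simpa [d, h₁] using hv
  refine ⟨range d, countable_range _, ?_, ?_⟩
  · rw [dense_iff_inter_open]
    intro O hO hne
    obtain ⟨n, hn⟩ := hB O hO hne
    refine ⟨_, hn (d n) fun i hi => ?_, mem_range_self n⟩
    simpa [d, hi] using hw n i
  · rintro _ ⟨m, rfl⟩ _ ⟨n, rfl⟩ hmn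
    rcases lt_trichotomy m n with h | rfl | h
    · exact hsep m n h
    · exact absurd rfl hmn
    · exact (hsep n m h).symm

/-- If any two nonempty open sets of `Z` meet, then its countable power has a countable dense set
all of whose infinite subsets are dense. -/
theorem CountablePiWeight.exists_dense_forall_infinite_dense {Z : Type*} [TopologicalSpace Z]
    [PreirreducibleSpace Z] [Nonempty Z] (hp : CountablePiWeight Z) :
    ∃ D : Set (ℕ → Z), D.Countable ∧ Dense D ∧ ∀ A ⊆ D, A.Infinite → Dense A := by
  obtain ⟨N, V, hV, hB⟩ := hp.exists_seq_boxes
  have hne : ∀ n i, IsOpen (⋂ m ∈ Finset.range (n + 1), V m i) ∧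
      (⋂ m ∈ Finset.range (n + 1), V m i).Nonempty := by
    intro n i
    induction n with
    | zero => simpa using hV 0 i
    | succ n ih =>
      rw [Finset.range_add_one, Finset.set_biInter_insert]
      exact ⟨(hV _ i).1.inter ih.1,
        nonempty_preirreducible_inter (hV _ i).1 ih.1 (hV _ i).2 ih.2⟩
  choose d hd using fun n i => (hne n i).2
  have hdV : ∀ m n i, m ≤ n → d n i ∈ V m i := fun m n i hmn =>
    mem_iInter₂.1 (hd n i) m (Finset.mem_range.2 (Nat.lt_succ_of_le hmn))
  refine ⟨range d, countable_range _, ?_, fun A hA hinf => ?_⟩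
  all_goals
    rw [dense_iff_inter_open]
    intro U hU hne
    obtain ⟨m, hm⟩ := hB U hU hne
  · exact ⟨_, hm _ fun i _ => hdV m m i le_rfl, mem_range_self m⟩
  · have hinf' : (d ⁻¹' A).Infinite := hinf.preimage hA
    obtain ⟨n, hn, hmn⟩ := hinf'.exists_gt m
    exact ⟨d n, hm _ fun i _ => hdV m n i hmn.le, hn⟩

/-- In a countable dense homogeneous space, any countable set can be moved into any given countable
dense set. -/
theorem CDH.exists_homeomorph_mapsTo {X : Type*} [TopologicalSpace X] (h : CDH X) {D A : Set X}
    (hD : D.Countable) (hDd : Dense D) (hA : A.Countable) : ∃ e : X ≃ₜ X, MapsTo e A D := by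
  obtain ⟨e, he⟩ := h (D ∪ A) D (hD.union hA) (hDd.mono subset_union_left) hD hDd
  exact ⟨e, fun a ha => he ▸ mem_image_of_mem e (Or.inr ha)⟩

theorem CDH.not_preirreducibleSpace {Z : Type*} [TopologicalSpace Z] [Nontrivial Z]
    (hp : CountablePiWeight Z) (h : CDH (ℕ → Z)) : ¬ PreirreducibleSpace Z := by
  intro _
  by_cases hC : ∃ C : Set Z, IsClosed C ∧ C.Nonempty ∧ C ≠ univ
  · obtain ⟨C, hC, ⟨c, hc⟩, hCu⟩ := hC
    obtain ⟨x, hx⟩ := (ne_univ_iff_exists_notMem C).1 hCu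
    obtain ⟨D, hDc, hD, hDinf⟩ := hp.exists_dense_forall_infinite_dense
    let a : ℕ → ℕ → Z := fun n => Function.update (fun _ => c) (n + 1) x
    have hcx : c ≠ x := by rintro rfl; exact hx hc
    have ha : Function.Injective a := by
      intro m n hmn
      by_contra hne
      have := congrFun hmn (m + 1)
      simp [a, Function.update_of_ne (show m + 1 ≠ n + 1 by omega)] at this
      exact hcx this.symm
    obtain ⟨e, he⟩ := h.exists_homeomorph_mapsTo hDc hD (countable_range a)
    have hd := hDinf _ he.image_subset ((infinite_range_of_injective ha).image e.injective.injOn)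
    have hd' : Dense (range a) := by
      have := e.symm.surjective.denseRange.dense_image e.symm.continuous hd
      simpa [image_image] using this
    have hcl : IsClosed ((fun f : ℕ → Z => f 0) ⁻¹' C) := hC.preimage (continuous_apply 0)
    have hsub : range a ⊆ (fun f : ℕ → Z => f 0) ⁻¹' C := by
      rintro _ ⟨n, rfl⟩
      simpa [a] using hc
    exact hx (hcl.closure_subset_iff.2 hsub (hd' fun _ => x))
  · push Not at hC
    obtain ⟨p, q, hpq⟩ := exists_pair_ne (ℕ → Z)
    have hclos : ∀ z : Z, closure {z} = univ := fun z =>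
      hC _ isClosed_closure (singleton_nonempty z).closure
    have hd : Dense ({p} : Set (ℕ → Z)) := by
      have : ({p} : Set (ℕ → Z)) = univ.pi fun i => {p i} :=
        (univ_pi_singleton p).symm
      rw [dense_iff_closure_eq, this, closure_pi_set]
      simp [hclos]
    obtain ⟨e, he⟩ := h.exists_homeomorph_mapsTo (countable_singleton p) hd
      (countable_insert.2 (countable_singleton q) : ({p, q} : Set (ℕ → Z)).Countable)
    apply hpq
    apply e.injective
    exact (he (by simp : p ∈ _)).trans (he (by simp : q ∈ _)).symm

theorem CDH.t2Space {Z : Type*} [TopologicalSpace Z]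
    (hp : CountablePiWeight Z) (h : CDH (ℕ → Z)) : T2Space Z := by
  rw [t2Space_iff]
  intro x y hxy
  have : Nontrivial Z := ⟨x, y, hxy⟩
  obtain ⟨U, V, hU, hV, hUne, hVne, hUV⟩ : ∃ U V : Set Z, IsOpen U ∧ IsOpen V ∧ U.Nonempty ∧
      V.Nonempty ∧ Disjoint U V := by
    by_contra hcon
    push Not at hcon
    refine CDH.not_preirreducibleSpace hp h ⟨fun U V hU hV hUne hVne => ?_⟩
    rw [univ_inter] at hUne hVne ⊢
    exact not_disjoint_iff_nonempty_inter.1 (hcon U V hU hV hUne hVne)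
  obtain ⟨D, hDc, hD, hsep⟩ := hp.exists_dense_separated hU hV hUne hVne hUV
  obtain ⟨e, he⟩ := h.exists_homeomorph_mapsTo hDc hD
    ((countable_singleton (fun _ => y)).insert (fun _ => x) : ({fun _ => x, fun _ => y} :
      Set (ℕ → Z)).Countable)
  have hne : e (fun _ => x) ≠ e (fun _ => y) := fun hexy => hxy (congrFun (e.injective hexy) 0)
  obtain ⟨O, P, hO, hP, hxO, hyP, hOP⟩ := hsep _ (he (by simp)) _ (he (by simp)) hne
  have hc : Continuous fun z : Z => e fun _ => z :=
    e.continuous.comp (continuous_pi fun _ => continuous_id)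
  exact ⟨_, _, hO.preimage hc, hP.preimage hc, hxO rfl, hyP rfl, hOP.preimage _⟩

theorem power_not_CDH_of_no_cantor (Z : Type*) [TopologicalSpace Z]
    (hZ : Crowded Z) (hp : CountablePiWeight Z) (hc : ¬ ContainsCantor Z) :
    ¬ CDH (ℕ → Z) := by
  intro h
  have := CDH.t2Space hp h
  obtain ⟨D, hDc, hD, hinj⟩ := hZ.exists_dense_injOn_eval hp
  have := hZ.1
  obtain ⟨x, -, y, -, hxy⟩ := (hZ.infinite_of_isOpen isOpen_univ univ_nonempty).nontrivial
  let κ : (ℕ → Bool) → ℕ → Z := fun s i => if s i then x else y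
  have hκ : Continuous κ := continuous_pi fun i =>
    (continuous_of_discreteTopology (f := fun b : Bool => if b then x else y)).comp
      (continuous_apply i)
  have hκi : Function.Injective κ := by
    intro s t hst
    ext i
    have := congrFun hst i
    cases hs : s i <;> cases ht : t i <;> simp_all [κ]
  obtain ⟨Q, hQc, hQ⟩ := TopologicalSpace.exists_countable_dense (ℕ → Bool)
  obtain ⟨e, he⟩ := h.exists_homeomorph_mapsTo hDc hD (hQc.image κ)
  apply hc
  refine containsCantor_of_injOn_dense (g := fun s => e (κ s) 0)
    ((continuous_apply 0).comp (e.continuous.comp hκ)) hQ fun s hs t ht hst => ?_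
  exact hκi (e.injective (hinj (he (mem_image_of_mem κ hs)) (he (mem_image_of_mem κ ht)) hst))
end
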